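/- arXiv:2510.04407 — 2 statements merged into one kernel-verified Lean document; each statement's English description precedes it below -/
import Mathlib

section
/- Run IREG-PRM⁺ in self-play on the zero-sum game max_{x ∈ Δ(m)} min_{y ∈ Δ(n)} xᵀAy with initialization r̃_𝒳^(1) = 0 and r̃_𝒴^(1) = 0. Then there exists a constant C ≥ 0, independent of T, such that for every T ≥ 1 there is a time t ∈ {1, …, T} at which the strategy profile (x^(t), y^(t)) has duality gap (Nash gap) at most C/√T. -/
open Matrix

/-- ℓ₂ norm of a vector in ℝ^d. -/
noncomputable def l2 {d : ℕ} (v : Fin d → ℝ) : ℝ := Real.sqrt (∑ i, (v i) ^ 2)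

/-- ℓ₁ norm of a vector in ℝ^d. -/
def l1 {d : ℕ} (v : Fin d → ℝ) : ℝ := ∑ i, |v i|

/-- Standard inner product on ℝ^d. -/
def dotp {d : ℕ} (v w : Fin d → ℝ) : ℝ := ∑ i, v i * w i

/-- Coordinatewise positive part `[v]⁺`. -/
def ppart {d : ℕ} (v : Fin d → ℝ) : Fin d → ℝ := fun i => max (v i) 0

/-- A run of the IR-PRM⁺ algorithm on the simplex `Δ(n)`, with utilities `u`,
predictions `m`, regret vectors `rt` (`r̃`) and `r`, normalization constants
`gam` (`γ`), and strategies `x`, `xt` (`x̃`); `g` is the shifted utility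
increment.  All quantities are indexed starting from time `1`. -/
structure IRPRMp (n : ℕ) where
  u : ℕ → Fin n → ℝ
  m : ℕ → Fin n → ℝ
  rt : ℕ → Fin n → ℝ
  gam : ℕ → ℝ
  r : ℕ → Fin n → ℝ
  x : ℕ → Fin n → ℝ
  xt : ℕ → Fin n → ℝ
  g : ℕ → Fin n → ℝ
  rt1_nonneg : ∀ i, 0 ≤ rt 1 i
  xt1_mem : rt 1 = 0 → xt 1 ∈ stdSimplex ℝ (Fin n)
  xt1_eq : rt 1 ≠ 0 → xt 1 = (l1 (rt 1))⁻¹ • rt 1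
  zero_case : ∀ t, 1 ≤ t → rt t = 0 →
      m t = 0 ∧ gam t = 0 ∧ r t = 0 ∧ x t = xt t
  gam_spec : ∀ t, 1 ≤ t → rt t ≠ 0 →
      l2 (ppart (rt t + m t - gam t • (1 : Fin n → ℝ))) = l2 (rt t)
  r_def : ∀ t, 1 ≤ t → rt t ≠ 0 →
      r t = rt t + m t - gam t • (1 : Fin n → ℝ)
  x_def : ∀ t, 1 ≤ t → rt t ≠ 0 →
      x t = (l1 (ppart (r t)))⁻¹ • ppart (r t)
  g_def : ∀ t, 1 ≤ t →
      g t = u t - m t - (dotp (u t - m t) (x t)) • (1 : Fin n → ℝ)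
  rt_succ : ∀ t, 1 ≤ t → rt (t + 1) = ppart (r t + g t)
  xt_succ_ne : ∀ t, 1 ≤ t → rt (t + 1) ≠ 0 →
      xt (t + 1) = (l1 (rt (t + 1)))⁻¹ • rt (t + 1)
  xt_succ_zero : ∀ t, 1 ≤ t → rt (t + 1) = 0 → xt (t + 1) = x t

theorem ppart_nonneg {d : ℕ} (v : Fin d → ℝ) (i : Fin d) : 0 ≤ ppart v i := le_max_right _ _

theorem sum_mul_mem_simplex_le {d : ℕ} {x : Fin d → ℝ} (hx : x ∈ stdSimplex ℝ (Fin d))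
    {v : Fin d → ℝ} {c : ℝ} (hv : ∀ i, v i ≤ c) : ∑ i, x i * v i ≤ c := by
  calc ∑ i, x i * v i ≤ ∑ i, x i * c :=
        Finset.sum_le_sum fun i _ => mul_le_mul_of_nonneg_left (hv i) (hx.1 i)
    _ = c := by rw [← Finset.sum_mul, hx.2, one_mul]

theorem sum_pos_of_nonneg_of_ne_zero {d : ℕ} {v : Fin d → ℝ} (h0 : ∀ i, 0 ≤ v i) (hv : v ≠ 0) :
    0 < ∑ i, v i := by
  refine lt_of_le_of_ne (Finset.sum_nonneg fun i _ => h0 i) fun h => hv ?_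
  funext i
  exact (Finset.sum_eq_zero_iff_of_nonneg fun i _ => h0 i).1 h.symm i (Finset.mem_univ i)

theorem l1_of_nonneg {d : ℕ} {v : Fin d → ℝ} (h0 : ∀ i, 0 ≤ v i) : l1 v = ∑ i, v i :=
  Finset.sum_congr rfl fun i _ => abs_of_nonneg (h0 i)

theorem normalize_mem_stdSimplex {d : ℕ} {v : Fin d → ℝ} (h0 : ∀ i, 0 ≤ v i) (hv : v ≠ 0) :
    (l1 v)⁻¹ • v ∈ stdSimplex ℝ (Fin d) := by
  have hp := sum_pos_of_nonneg_of_ne_zero h0 hv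
  rw [l1_of_nonneg h0]
  refine ⟨fun i => mul_nonneg (inv_nonneg.2 hp.le) (h0 i), ?_⟩
  simp only [Pi.smul_apply, smul_eq_mul, ← Finset.mul_sum]
  exact inv_mul_cancel₀ hp.ne'

theorem sum_sq_pos_of_ne_zero {d : ℕ} {v : Fin d → ℝ} (hv : v ≠ 0) : 0 < ∑ i, v i ^ 2 := by
  refine sum_pos_of_nonneg_of_ne_zero (v := fun i => v i ^ 2) (fun i => sq_nonneg _) fun h => hv ?_
  funext i
  exact pow_eq_zero_iff (two_ne_zero) |>.1 (congrFun h i)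

/-- Normalizing onto the simplex is Lipschitz away from the origin, in the `ℓ₁` norm. -/
theorem l1_normalize_sub_le {d : ℕ} {a b : Fin d → ℝ} (hb0 : ∀ i, 0 ≤ b i)
    (ha : 0 < ∑ i, a i) (hb : 0 < ∑ i, b i) :
    ∑ i, |(∑ i, a i)⁻¹ * a i - (∑ i, b i)⁻¹ * b i| ≤ 2 * (∑ i, |a i - b i|) / ∑ i, a i := by
  set p := ∑ i, a i with hp
  set q := ∑ i, b i with hq
  have hqp : |q - p| ≤ ∑ i, |a i - b i| := by
    rw [abs_sub_comm, hp, hq, ← Finset.sum_sub_distrib]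
    exact Finset.abs_sum_le_sum_abs _ _
  have key : ∀ i, |p⁻¹ * a i - q⁻¹ * b i| ≤ p⁻¹ * |a i - b i| + p⁻¹ * q⁻¹ * |q - p| * b i := by
    intro i
    have : p⁻¹ * a i - q⁻¹ * b i = p⁻¹ * (a i - b i) + p⁻¹ * q⁻¹ * (q - p) * b i := by
      field_simp
      ring
    rw [this]
    refine (abs_add_le _ _).trans ?_
    rw [abs_mul, abs_mul, abs_mul, abs_of_nonneg (inv_nonneg.2 ha.le), abs_of_nonneg (hb0 i),
      abs_of_nonneg (mul_nonneg (inv_nonneg.2 ha.le) (inv_nonneg.2 hb.le))]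
  calc _ ≤ ∑ i, (p⁻¹ * |a i - b i| + p⁻¹ * q⁻¹ * |q - p| * b i) :=
        Finset.sum_le_sum fun i _ => key i
    _ = p⁻¹ * ∑ i, |a i - b i| + p⁻¹ * |q - p| := by
        rw [Finset.sum_add_distrib, ← Finset.mul_sum, ← Finset.mul_sum, ← hq]
        field_simp
    _ ≤ p⁻¹ * ∑ i, |a i - b i| + p⁻¹ * ∑ i, |a i - b i| := by gcongr
    _ = _ := by ring

theorem sq_sum_le_card_mul {d : ℕ} (v : Fin d → ℝ) :
    (∑ i, v i) ^ 2 ≤ d * ∑ i, v i ^ 2 := by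
  simpa using sq_sum_le_card_mul_sum_sq (s := (Finset.univ : Finset (Fin d))) (f := v)

theorem abs_mulVec_sub_le {m n : ℕ} (A : Matrix (Fin m) (Fin n) ℝ) (y z : Fin n → ℝ) (i : Fin m) :
    |(A *ᵥ y - A *ᵥ z) i| ≤ (∑ i, ∑ j, |A i j|) * ∑ j, |y j - z j| := by
  rw [← Matrix.mulVec_sub]
  have h1 : ∀ j, |A i j| ≤ ∑ i, ∑ j, |A i j| := fun j =>
    (Finset.single_le_sum (f := fun j => |A i j|) (fun _ _ => abs_nonneg _)
      (Finset.mem_univ j)).trans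
    (Finset.single_le_sum (f := fun i => ∑ j, |A i j|)
      (fun _ _ => Finset.sum_nonneg fun _ _ => abs_nonneg _) (Finset.mem_univ i))
  calc |(A *ᵥ (y - z)) i| ≤ ∑ j, |A i j * (y j - z j)| := by
        rw [Matrix.mulVec_eq_sum, Finset.sum_apply]
        refine (Finset.abs_sum_le_sum_abs _ _).trans (le_of_eq ?_)
        simp
    _ ≤ ∑ j, (∑ i, ∑ j, |A i j|) * |y j - z j| := by
        refine Finset.sum_le_sum fun j _ => ?_
        rw [abs_mul]
        exact mul_le_mul_of_nonneg_right (h1 j) (abs_nonneg _)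
    _ = _ := by rw [Finset.mul_sum]

namespace IRPRMp

variable {n : ℕ} (alg : IRPRMp n)

/-- The squared `ℓ₂` norm of `r̃`. -/
def normSq (t : ℕ) : ℝ := ∑ i, alg.rt t i ^ 2

/-- The squared `ℓ₁` distance between the strategy and the predicted strategy. -/
def moveSq (t : ℕ) : ℝ := (∑ i, |alg.x t i - alg.xt t i|) ^ 2

/-- The squared `ℓ₂` distance between consecutive `r̃`. -/
def stepSq (t : ℕ) : ℝ := ∑ i, (alg.rt (t + 1) i - alg.rt t i) ^ 2

/-- The excess by which the normalization constant `γ` falls below `⟨m, x⟩`. -/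
noncomputable def excess (t : ℕ) : ℝ :=
  (∑ i, (ppart (alg.r t) i - alg.rt t i) ^ 2) / (2 * ∑ i, ppart (alg.r t) i)

theorem normSq_nonneg (t : ℕ) : 0 ≤ alg.normSq t := Finset.sum_nonneg fun _ _ => sq_nonneg _

theorem moveSq_nonneg (t : ℕ) : 0 ≤ alg.moveSq t := sq_nonneg _

theorem stepSq_nonneg (t : ℕ) : 0 ≤ alg.stepSq t := Finset.sum_nonneg fun _ _ => sq_nonneg _

theorem excess_nonneg (t : ℕ) : 0 ≤ alg.excess t :=
  div_nonneg (Finset.sum_nonneg fun _ _ => sq_nonneg _)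
    (mul_nonneg zero_le_two (Finset.sum_nonneg fun _ _ => ppart_nonneg _ _))

theorem rt_nonneg {t : ℕ} (ht : 1 ≤ t) (i : Fin n) : 0 ≤ alg.rt t i := by
  obtain _ | _ | t := t
  · omega
  · exact alg.rt1_nonneg i
  · rw [alg.rt_succ (t + 1) (by omega)]
    exact ppart_nonneg _ _

theorem sum_sq_ppart_r {t : ℕ} (ht : 1 ≤ t) : ∑ i, ppart (alg.r t) i ^ 2 = alg.normSq t := by
  by_cases h : alg.rt t = 0
  · obtain ⟨-, -, hr, -⟩ := alg.zero_case t ht h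
    simp [normSq, h, hr, ppart]
  · have := alg.gam_spec t ht h
    rw [← alg.r_def t ht h] at this
    exact (Real.sqrt_inj (Finset.sum_nonneg fun _ _ => sq_nonneg _)
      (Finset.sum_nonneg fun _ _ => sq_nonneg _)).1 this

theorem ppart_r_ne_zero {t : ℕ} (ht : 1 ≤ t) (h : alg.rt t ≠ 0) : ppart (alg.r t) ≠ 0 := by
  intro h0
  have := alg.sum_sq_ppart_r ht
  rw [h0] at this
  have h2 : 0 < alg.normSq t := sum_sq_pos_of_ne_zero h
  simp at this
  linarith

theorem sum_ppart_r_pos {t : ℕ} (ht : 1 ≤ t) (h : alg.rt t ≠ 0) :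
    0 < ∑ i, ppart (alg.r t) i :=
  sum_pos_of_nonneg_of_ne_zero (ppart_nonneg _) (alg.ppart_r_ne_zero ht h)

theorem x_apply {t : ℕ} (ht : 1 ≤ t) (h : alg.rt t ≠ 0) (i : Fin n) :
    alg.x t i = (∑ i, ppart (alg.r t) i)⁻¹ * ppart (alg.r t) i := by
  rw [alg.x_def t ht h, l1_of_nonneg (ppart_nonneg _)]
  rfl

theorem xt_apply {t : ℕ} (ht : 1 ≤ t) (h : alg.rt t ≠ 0) (i : Fin n) :
    alg.xt t i = (∑ i, alg.rt t i)⁻¹ * alg.rt t i := by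
  have : alg.xt t = (l1 (alg.rt t))⁻¹ • alg.rt t := by
    obtain _ | _ | t := t
    · omega
    · exact alg.xt1_eq h
    · exact alg.xt_succ_ne (t + 1) (by omega) h
  rw [this, l1_of_nonneg (alg.rt_nonneg ht)]
  rfl

theorem x_mem {t : ℕ} (ht : 1 ≤ t) : alg.x t ∈ stdSimplex ℝ (Fin n) := by
  induction t, ht using Nat.le_induction with
  | base =>
    by_cases h : alg.rt 1 = 0
    · rw [(alg.zero_case 1 le_rfl h).2.2.2]
      exact alg.xt1_mem h
    · rw [alg.x_def 1 le_rfl h]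
      exact normalize_mem_stdSimplex (ppart_nonneg _) (alg.ppart_r_ne_zero le_rfl h)
  | succ t ht ih =>
    by_cases h : alg.rt (t + 1) = 0
    · rw [(alg.zero_case (t + 1) (by omega) h).2.2.2, alg.xt_succ_zero t ht h]
      exact ih
    · rw [alg.x_def (t + 1) (by omega) h]
      exact normalize_mem_stdSimplex (ppart_nonneg _) (alg.ppart_r_ne_zero (by omega) h)

theorem sum_sq_sub_eq {t : ℕ} (ht : 1 ≤ t) :
    ∑ i, (ppart (alg.r t) i - alg.rt t i) ^ 2
      = 2 * (∑ i, ppart (alg.r t) i) * alg.excess t := by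
  by_cases h : alg.rt t = 0
  · obtain ⟨-, -, hr, -⟩ := alg.zero_case t ht h
    simp [h, hr, ppart]
  · have := alg.sum_ppart_r_pos ht h
    rw [excess]
    field_simp

theorem dotp_m_sub_gam {t : ℕ} (ht : 1 ≤ t) (h : alg.rt t ≠ 0) :
    dotp (alg.m t) (alg.x t) - alg.gam t = alg.excess t := by
  have hS := alg.sum_ppart_r_pos ht h
  have h1 := alg.sum_sq_sub_eq ht
  have hr := alg.r_def t ht h
  have hn := alg.sum_sq_ppart_r ht
  set θ := ppart (alg.r t) with hθ
  set S := ∑ i, θ i with hSd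
  have hx : S * dotp (alg.m t) (alg.x t) = ∑ i, θ i * alg.m t i := by
    rw [dotp, Finset.mul_sum]
    refine Finset.sum_congr rfl fun i _ => ?_
    rw [alg.x_apply ht h, ← hθ, ← hSd]
    field_simp
  have hsq : ∀ i, θ i ^ 2 = θ i * alg.rt t i + θ i * alg.m t i - alg.gam t * θ i := by
    intro i
    have e1 : θ i ^ 2 = θ i * alg.r t i := by
      simp only [hθ, ppart]
      rcases le_total (alg.r t i) 0 with h | h
      · simp [max_eq_right h]
      · rw [max_eq_left h, sq]
    rw [e1, hr]
    simp
    ring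
  have hs : ∑ i, θ i ^ 2
      = ∑ i, θ i * alg.rt t i + ∑ i, θ i * alg.m t i - alg.gam t * S := by
    rw [hSd, Finset.mul_sum, ← Finset.sum_add_distrib, ← Finset.sum_sub_distrib]
    exact Finset.sum_congr rfl fun i _ => hsq i
  have hd : ∑ i, (θ i - alg.rt t i) ^ 2
      = ∑ i, θ i ^ 2 - 2 * ∑ i, θ i * alg.rt t i + alg.normSq t := by
    rw [normSq, Finset.mul_sum, ← Finset.sum_sub_distrib, ← Finset.sum_add_distrib]
    exact Finset.sum_congr rfl fun i _ => by ring
  have : S * (dotp (alg.m t) (alg.x t) - alg.gam t) = S * alg.excess t := by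
    linarith
  exact mul_left_cancel₀ hS.ne' this

theorem rt_add_regret_le {t : ℕ} (ht : 1 ≤ t) (i : Fin n) :
    alg.rt t i + (alg.u t i - dotp (alg.u t) (alg.x t)) + alg.excess t ≤ alg.rt (t + 1) i := by
  have hd : dotp (alg.u t - alg.m t) (alg.x t)
      = dotp (alg.u t) (alg.x t) - dotp (alg.m t) (alg.x t) := by
    simp [dotp, sub_mul]
  rw [alg.rt_succ t ht]
  refine le_trans (le_of_eq ?_) (le_max_left _ _)
  rw [Pi.add_apply, alg.g_def t ht, hd]
  by_cases h : alg.rt t = 0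
  · obtain ⟨hm, -, hr, -⟩ := alg.zero_case t ht h
    simp [excess, h, hr, hm, ppart, dotp]
  · rw [← alg.dotp_m_sub_gam ht h, alg.r_def t ht h]
    simp
    ring

theorem sum_ppart_r_mul_g {t : ℕ} (ht : 1 ≤ t) : ∑ i, ppart (alg.r t) i * alg.g t i = 0 := by
  by_cases h : alg.rt t = 0
  · obtain ⟨-, -, hr, -⟩ := alg.zero_case t ht h
    simp [hr, ppart]
  · have hS := alg.sum_ppart_r_pos ht h
    have e : ∀ i, ppart (alg.r t) i = (∑ i, ppart (alg.r t) i) * alg.x t i := by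
      intro i
      rw [alg.x_apply ht h]
      field_simp
    have h0 : ∑ i, alg.x t i * alg.g t i = 0 := by
      have hx := (alg.x_mem ht).2
      rw [alg.g_def t ht]
      simp only [Pi.sub_apply, Pi.smul_apply, Pi.one_apply, smul_eq_mul, mul_one, mul_sub,
        Finset.sum_sub_distrib, ← Finset.sum_mul, hx, one_mul]
      simp [dotp, sub_mul, mul_comm]
    calc _ = ∑ i, (∑ i, ppart (alg.r t) i) * (alg.x t i * alg.g t i) :=
          Finset.sum_congr rfl fun i _ => by rw [← mul_assoc, ← e i]
      _ = 0 := by rw [← Finset.mul_sum, h0, mul_zero]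

theorem normSq_succ_le {t : ℕ} (ht : 1 ≤ t) :
    alg.normSq (t + 1) ≤ alg.normSq t + ∑ i, alg.g t i ^ 2 := by
  have h0 := alg.sum_ppart_r_mul_g ht
  have key : ∀ i, alg.rt (t + 1) i ^ 2
      ≤ ppart (alg.r t) i ^ 2 + 2 * (ppart (alg.r t) i * alg.g t i) + alg.g t i ^ 2 := by
    intro i
    have e : ppart (alg.r t) i ^ 2 + 2 * (ppart (alg.r t) i * alg.g t i) + alg.g t i ^ 2
      = (ppart (alg.r t) i + alg.g t i) ^ 2 := by ring
    rw [e, alg.rt_succ t ht]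
    simp only [ppart, Pi.add_apply]
    rcases le_total (alg.r t i + alg.g t i) 0 with h | h
    · rw [max_eq_right h, zero_pow two_ne_zero]
      positivity
    · rw [max_eq_left h]
      have := le_max_left (alg.r t i) 0
      exact pow_le_pow_left₀ h (by linarith) 2
  have := Finset.sum_le_sum fun i (_ : i ∈ Finset.univ) => key i
  rw [Finset.sum_add_distrib, Finset.sum_add_distrib, ← Finset.mul_sum, h0,
    alg.sum_sq_ppart_r ht] at this
  simpa [normSq] using this

theorem normSq_le_succ {t : ℕ} (ht : 1 ≤ t) : alg.normSq t ≤ alg.normSq (t + 1) := by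
  have h0 := alg.sum_ppart_r_mul_g ht
  have key : ∀ i, ppart (alg.r t) i ^ 2 + 2 * (ppart (alg.r t) i * alg.g t i)
      ≤ alg.rt (t + 1) i ^ 2 := by
    intro i
    rw [alg.rt_succ t ht]
    simp only [ppart, Pi.add_apply]
    have h1 := le_max_left (alg.r t i + alg.g t i) 0
    have h2 := le_max_right (alg.r t i + alg.g t i) 0
    rcases le_total (alg.r t i) 0 with h | h
    · rw [max_eq_right h]
      simp only [zero_mul, mul_zero, add_zero, zero_pow two_ne_zero]
      positivity
    · rw [max_eq_left h]
      nlinarith [mul_le_mul_of_nonneg_left h1 h,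
        sq_nonneg (max (alg.r t i + alg.g t i) 0 - alg.r t i)]
  have := Finset.sum_le_sum fun i (_ : i ∈ Finset.univ) => key i
  rw [Finset.sum_add_distrib, ← Finset.mul_sum, h0, alg.sum_sq_ppart_r ht] at this
  simpa [normSq] using this

theorem stepSq_le {t : ℕ} (ht : 1 ≤ t) :
    alg.stepSq t
      ≤ 2 * ∑ i, alg.g t i ^ 2 + 4 * (∑ i, ppart (alg.r t) i) * alg.excess t := by
  have key : ∀ i, (alg.rt (t + 1) i - alg.rt t i) ^ 2
      ≤ 2 * alg.g t i ^ 2 + 2 * (ppart (alg.r t) i - alg.rt t i) ^ 2 := by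
    intro i
    have h1 : |alg.rt (t + 1) i - ppart (alg.r t) i| ≤ |alg.g t i| := by
      rw [alg.rt_succ t ht]
      refine (abs_max_sub_max_le_abs _ _ _).trans ?_
      simp
    have h2 := sq_le_sq.2 h1
    nlinarith [sq_nonneg (alg.rt (t + 1) i - ppart (alg.r t) i
      - (ppart (alg.r t) i - alg.rt t i))]
  have := Finset.sum_le_sum fun i (_ : i ∈ Finset.univ) => key i
  rw [Finset.sum_add_distrib, ← Finset.mul_sum, ← Finset.mul_sum, alg.sum_sq_sub_eq ht] at this
  rw [stepSq]
  linarith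

theorem sum_ppart_r_le {t : ℕ} (ht : 1 ≤ t) :
    ∑ i, ppart (alg.r t) i ≤ n * √(alg.normSq t) := by
  calc ∑ i, ppart (alg.r t) i ≤ ∑ _i : Fin n, √(alg.normSq t) := by
        refine Finset.sum_le_sum fun i _ => Real.le_sqrt_of_sq_le ?_
        rw [← alg.sum_sq_ppart_r ht]
        exact Finset.single_le_sum (f := fun i => ppart (alg.r t) i ^ 2)
          (fun _ _ => sq_nonneg _) (Finset.mem_univ i)
    _ = _ := by simp

theorem le_sum_ppart_r {t : ℕ} (ht : 1 ≤ t) :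
    √(alg.normSq t) ≤ ∑ i, ppart (alg.r t) i := by
  refine Real.sqrt_le_iff.2 ⟨Finset.sum_nonneg fun _ _ => ppart_nonneg _ _, ?_⟩
  rw [← alg.sum_sq_ppart_r ht]
  exact Finset.sum_sq_le_sq_sum_of_nonneg fun _ _ => ppart_nonneg _ _

theorem moveSq_le {t : ℕ} (ht : 1 ≤ t) (h : alg.rt t ≠ 0) :
    alg.moveSq t ≤ 8 * n / √(alg.normSq t) * alg.excess t := by
  have hS := alg.sum_ppart_r_pos ht h
  have hb := sum_pos_of_nonneg_of_ne_zero (alg.rt_nonneg ht) h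
  have h1 := l1_normalize_sub_le (a := ppart (alg.r t)) (alg.rt_nonneg ht) hS hb
  have h2 := sq_sum_le_card_mul fun i => |ppart (alg.r t) i - alg.rt t i|
  simp only [sq_abs] at h2
  rw [alg.sum_sq_sub_eq ht] at h2
  have hR : 0 < √(alg.normSq t) := Real.sqrt_pos.2 (sum_sq_pos_of_ne_zero h)
  have hle := alg.le_sum_ppart_r ht
  have hD := alg.excess_nonneg t
  set S := ∑ i, ppart (alg.r t) i with hSd
  rw [moveSq]
  simp only [alg.x_apply ht h, alg.xt_apply ht h]
  rw [← hSd]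
  calc _ ≤ (2 * (∑ i, |ppart (alg.r t) i - alg.rt t i|) / S) ^ 2 :=
        pow_le_pow_left₀ (Finset.sum_nonneg fun _ _ => abs_nonneg _) h1 2
    _ = 4 * (∑ i, |ppart (alg.r t) i - alg.rt t i|) ^ 2 / S ^ 2 := by ring
    _ ≤ 4 * (n * (2 * S * alg.excess t)) / S ^ 2 := by gcongr
    _ = 8 * n / S * alg.excess t := by
        field_simp
        ring
    _ ≤ _ := by gcongr

theorem sum_sq_g_le {t : ℕ} (ht : 1 ≤ t) {c : ℝ} (h : ∀ i, |alg.u t i - alg.m t i| ≤ c) :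
    ∑ i, alg.g t i ^ 2 ≤ 4 * n * c ^ 2 := by
  have hx := alg.x_mem ht
  have hd : |dotp (alg.u t - alg.m t) (alg.x t)| ≤ c := by
    rw [dotp]
    refine (Finset.abs_sum_le_sum_abs _ _).trans ?_
    have := sum_mul_mem_simplex_le hx h
    refine le_trans (le_of_eq (Finset.sum_congr rfl fun i _ => ?_)) this
    rw [abs_mul, abs_of_nonneg (hx.1 i), mul_comm]
    rfl
  calc ∑ i, alg.g t i ^ 2 ≤ ∑ _i : Fin n, 4 * c ^ 2 := by
        refine Finset.sum_le_sum fun i _ => ?_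
        rw [alg.g_def t ht]
        simp only [Pi.sub_apply, Pi.smul_apply, Pi.one_apply, smul_eq_mul, mul_one]
        have h1 := abs_le.1 (h i)
        have h2 := abs_le.1 hd
        nlinarith
    _ = _ := by
        simp
        ring

theorem normSq_mono {s t : ℕ} (hs : 1 ≤ s) (hst : s ≤ t) : alg.normSq s ≤ alg.normSq t := by
  induction t, hst using Nat.le_induction with
  | base => exact le_rfl
  | succ t hst ih => exact ih.trans (alg.normSq_le_succ (hs.trans hst))

/-- The estimates driving the convergence proof; they hold once `r̃` has left the origin, and
also if it never does. -/
theorem eventually_estimates {α : ℝ} {e : ℕ → ℝ} (he : ∀ t, 0 ≤ e t)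
    (hum : ∀ t, 1 ≤ t → alg.rt t ≠ 0 → ∀ i, |alg.u t i - alg.m t i| ≤ α * √(e t)) :
    ∃ K : ℝ, 0 ≤ K ∧ ∀ᶠ t in Filter.atTop,
      alg.moveSq t ≤ K * alg.excess t ∧
      alg.normSq (t + 1) ≤ alg.normSq t + K * e t ∧
      alg.stepSq t ≤ K * (e t + √(alg.normSq t) * alg.excess t) := by
  by_cases hz : ∀ t, 1 ≤ t → alg.rt t = 0
  · refine ⟨0, le_rfl, Filter.eventually_atTop.2 ⟨1, fun t ht => ?_⟩⟩
    simp [moveSq, normSq, stepSq, hz t ht, hz (t + 1) (by omega),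
      (alg.zero_case t ht (hz t ht)).2.2.2]
  · push Not at hz
    obtain ⟨s, hs, hne⟩ := hz
    have hpos : 0 < alg.normSq s := sum_sq_pos_of_ne_zero hne
    have hpos' := Real.sqrt_pos.2 hpos
    set K₁ := 8 * n / √(alg.normSq s) with hK₁
    have hK₁0 : 0 ≤ K₁ := by positivity
    set K₂ := 4 * n * α ^ 2 with hK₂
    have hK₂0 : 0 ≤ K₂ := by positivity
    refine ⟨K₁ + 2 * K₂ + 4 * n, by positivity, Filter.eventually_atTop.2 ⟨s, fun t hst => ?_⟩⟩
    have ht : 1 ≤ t := hs.trans hst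
    have hmono := alg.normSq_mono hs hst
    have h : alg.rt t ≠ 0 := by
      intro h
      simp only [normSq, h] at hmono hpos
      simp at hmono
      linarith
    have hD := alg.excess_nonneg t
    have hR := Real.sqrt_nonneg (alg.normSq t)
    have het := he t
    have hg : ∑ i, alg.g t i ^ 2 ≤ K₂ * e t := by
      have := alg.sum_sq_g_le ht (hum t ht h)
      rwa [mul_pow, Real.sq_sqrt het, ← mul_assoc] at this
    refine ⟨?_, ?_, ?_⟩
    · calc alg.moveSq t ≤ 8 * n / √(alg.normSq t) * alg.excess t := alg.moveSq_le ht h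
        _ ≤ K₁ * alg.excess t := by
            rw [hK₁]
            gcongr
        _ ≤ _ := by
            gcongr
            linarith [Nat.cast_nonneg (α := ℝ) n]
    · refine (alg.normSq_succ_le ht).trans ?_
      gcongr
      refine hg.trans ?_
      gcongr
      linarith [Nat.cast_nonneg (α := ℝ) n]
    · have h1 := alg.stepSq_le ht
      have h2 := mul_le_mul_of_nonneg_right (alg.sum_ppart_r_le ht) hD
      have hn : (0 : ℝ) ≤ n := Nat.cast_nonneg n
      have h3 : 0 ≤ √(alg.normSq t) * alg.excess t := mul_nonneg hR hD
      nlinarith [mul_nonneg hK₁0 het, mul_nonneg hK₁0 h3, mul_nonneg hK₂0 h3, mul_nonneg hn het]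

theorem sum_regret_add_excess_le {s : ℕ} (hs : 1 ≤ s) {t : ℕ} (hst : s ≤ t)
    {z : Fin n → ℝ} (hz : z ∈ stdSimplex ℝ (Fin n)) :
    ∑ k ∈ Finset.Ico s t, (dotp z (alg.u k) - dotp (alg.u k) (alg.x k))
      + ∑ k ∈ Finset.Ico s t, alg.excess k ≤ √(alg.normSq t) := by
  have key : ∑ k ∈ Finset.Ico s t, (dotp z (alg.u k) - dotp (alg.u k) (alg.x k))
      + ∑ k ∈ Finset.Ico s t, alg.excess k + ∑ i, z i * alg.rt s i ≤ ∑ i, z i * alg.rt t i := by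
    induction t, hst using Nat.le_induction with
    | base => simp
    | succ t hst ih =>
      rw [Finset.sum_Ico_succ_top hst, Finset.sum_Ico_succ_top hst]
      have h1 := sum_mul_mem_simplex_le hz (c := 0) (v := fun i => alg.rt t i
        + (alg.u t i - dotp (alg.u t) (alg.x t)) + alg.excess t - alg.rt (t + 1) i)
        fun i => sub_nonpos.2 (alg.rt_add_regret_le (hs.trans hst) i)
      simp only [mul_sub, mul_add, Finset.sum_sub_distrib, Finset.sum_add_distrib,
        ← Finset.sum_mul, hz.2, one_mul] at h1
      simp only [dotp] at *
      linarith
  have h0 : 0 ≤ ∑ i, z i * alg.rt s i :=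
    Finset.sum_nonneg fun i _ => mul_nonneg (hz.1 i) (alg.rt_nonneg hs i)
  have h1 : ∑ i, z i * alg.rt t i ≤ √(alg.normSq t) :=
    sum_mul_mem_simplex_le hz fun i => Real.le_sqrt_of_sq_le
      (Finset.single_le_sum (f := fun i => alg.rt t i ^ 2) (fun _ _ => sq_nonneg _)
        (Finset.mem_univ i))
  linarith

theorem dotp_u_le {t : ℕ} (ht : 1 ≤ t) {z : Fin n → ℝ} (hz : z ∈ stdSimplex ℝ (Fin n)) :
    dotp z (alg.u t) ≤ dotp (alg.u t) (alg.x t) + √(alg.stepSq t) := by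
  refine sum_mul_mem_simplex_le hz fun i => ?_
  have h1 := alg.rt_add_regret_le ht i
  have h2 : alg.rt (t + 1) i - alg.rt t i ≤ √(alg.stepSq t) :=
    Real.le_sqrt_of_sq_le (Finset.single_le_sum
      (f := fun i => (alg.rt (t + 1) i - alg.rt t i) ^ 2) (fun _ _ => sq_nonneg _)
      (Finset.mem_univ i))
  linarith [alg.excess_nonneg t]

end IRPRMp

theorem dotp_comm {d : ℕ} (v w : Fin d → ℝ) : dotp v w = dotp w v :=
  Finset.sum_congr rfl fun _ _ => mul_comm _ _

theorem dotp_transpose_mulVec {m n : ℕ} (A : Matrix (Fin m) (Fin n) ℝ) (x : Fin m → ℝ)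
    (y : Fin n → ℝ) : dotp (Aᵀ *ᵥ x) y = dotp x (A *ᵥ y) := by
  change (Aᵀ *ᵥ x) ⬝ᵥ y = x ⬝ᵥ (A *ᵥ y)
  rw [Matrix.mulVec_transpose, Matrix.dotProduct_mulVec]

theorem dotp_neg_right {d : ℕ} (v w : Fin d → ℝ) : dotp v (-w) = -dotp v w := by
  simp [dotp]

theorem dotp_neg_left {d : ℕ} (v w : Fin d → ℝ) : dotp (-v) w = -dotp v w := by
  simp [dotp]

/-- The regrets in a zero-sum game cannot both be negative, so the excesses are controlled by the
final regret norms. -/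
theorem sum_excess_le {m n : ℕ} (A : Matrix (Fin m) (Fin n) ℝ)
    (algX : IRPRMp m) (algY : IRPRMp n)
    (huX : ∀ t, 1 ≤ t → algX.u t = A *ᵥ algY.x t)
    (huY : ∀ t, 1 ≤ t → algY.u t = -(Aᵀ *ᵥ algX.x t)) {s t : ℕ} (hs : 1 ≤ s) (hst : s ≤ t) :
    ∑ k ∈ Finset.Ico s t, (algX.excess k + algY.excess k)
      ≤ √(algX.normSq t) + √(algY.normSq t) := by
  obtain rfl | hlt := hst.eq_or_lt
  · simp only [Finset.Ico_self, Finset.sum_empty]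
    positivity
  set I := Finset.Ico s t with hI
  have hI1 : ∀ k ∈ I, 1 ≤ k := fun k hk => hs.trans (Finset.mem_Ico.1 hk).1
  set f : ℕ → ℕ → ℝ := fun j k => dotp (algX.x j) (A *ᵥ algY.x k)
  have hX : ∀ j ∈ I, ∑ k ∈ I, (f j k - f k k) + ∑ k ∈ I, algX.excess k ≤ √(algX.normSq t) := by
    intro j hj
    refine le_trans (le_of_eq ?_)
      (algX.sum_regret_add_excess_le hs hst (algX.x_mem (hI1 j hj)))
    congr 1
    refine Finset.sum_congr rfl fun k hk => ?_
    rw [huX k (hI1 k hk), dotp_comm _ (algX.x k)]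
  have hY : ∀ j ∈ I, ∑ k ∈ I, (f k k - f k j) + ∑ k ∈ I, algY.excess k ≤ √(algY.normSq t) := by
    intro j hj
    refine le_trans (le_of_eq ?_)
      (algY.sum_regret_add_excess_le hs hst (algY.x_mem (hI1 j hj)))
    congr 1
    refine Finset.sum_congr rfl fun k hk => ?_
    rw [huY k (hI1 k hk), dotp_neg_right, dotp_neg_left, dotp_comm (algY.x j),
      dotp_transpose_mulVec, dotp_transpose_mulVec]
    ring
  have hsum := Finset.sum_le_sum fun j hj => add_le_add (hX j hj) (hY j hj)
  simp only [Finset.sum_add_distrib, Finset.sum_sub_distrib, Finset.sum_const, nsmul_eq_mul]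
    at hsum
  have hcomm : ∑ j ∈ I, ∑ k ∈ I, f k j = ∑ j ∈ I, ∑ k ∈ I, f j k := Finset.sum_comm
  have hc : (0 : ℝ) < I.card := by
    rw [hI, Nat.card_Ico]
    exact_mod_cast Nat.sub_pos_of_lt hlt
  rw [Finset.sum_add_distrib]
  refine le_of_mul_le_mul_left ?_ hc
  linarith

theorem dualityGap_le {m n : ℕ} (A : Matrix (Fin m) (Fin n) ℝ)
    (algX : IRPRMp m) (algY : IRPRMp n)
    (huX : ∀ t, 1 ≤ t → algX.u t = A *ᵥ algY.x t)
    (huY : ∀ t, 1 ≤ t → algY.u t = -(Aᵀ *ᵥ algX.x t)) {t : ℕ} (ht : 1 ≤ t) :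
    sSup ((fun xs : Fin m → ℝ => dotp xs (A *ᵥ algY.x t)) '' stdSimplex ℝ (Fin m))
      - sInf ((fun ys : Fin n → ℝ => dotp (Aᵀ *ᵥ algX.x t) ys) '' stdSimplex ℝ (Fin n))
      ≤ √(algX.stepSq t) + √(algY.stepSq t) := by
  have h1 : sSup ((fun xs : Fin m → ℝ => dotp xs (A *ᵥ algY.x t)) '' stdSimplex ℝ (Fin m))
      ≤ dotp (algX.x t) (A *ᵥ algY.x t) + √(algX.stepSq t) := by
    refine csSup_le (Set.Nonempty.image _ ⟨_, algX.x_mem ht⟩) ?_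
    rintro _ ⟨z, hz, rfl⟩
    have := algX.dotp_u_le ht hz
    rwa [huX t ht, dotp_comm _ (algX.x t)] at this
  have h2 : dotp (algX.x t) (A *ᵥ algY.x t) - √(algY.stepSq t)
      ≤ sInf ((fun ys : Fin n → ℝ => dotp (Aᵀ *ᵥ algX.x t) ys) '' stdSimplex ℝ (Fin n)) := by
    refine le_csInf (Set.Nonempty.image _ ⟨_, algY.x_mem ht⟩) ?_
    rintro _ ⟨z, hz, rfl⟩
    have := algY.dotp_u_le ht hz
    rw [huY t ht, dotp_neg_right, dotp_neg_left, dotp_comm z, dotp_transpose_mulVec _ _ (algY.x t)]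
      at this
    dsimp only
    linarith
  linarith

theorem le_of_sq_le_add_mul {w a b : ℝ} (ha : 0 ≤ a) (hb : 0 ≤ b) (h : w ^ 2 ≤ a + b * w) :
    w ≤ a + b + 1 := by
  by_contra! hw
  nlinarith [mul_nonneg ha (by linarith : 0 ≤ w - 1)]

/-- for IREG-PRM⁺ in self-play on a zero-sum game, initialized at
`r̃_X^(1) = 0`, `r̃_Y^(1) = 0`, there is a constant `C` independent of `T` such
that for every `T ≥ 1` some iterate `t ∈ {1,…,T}` has Nash (duality) gap at
most `C/√T`. -/
theorem stmt15
    {m n : ℕ} (A : Matrix (Fin m) (Fin n) ℝ)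
    (algX : IRPRMp m) (algY : IRPRMp n)
    -- extragradient predictions and utilities (IREG-PRM⁺ self-play coupling)
    (hmX : ∀ t, 1 ≤ t → algX.rt t ≠ 0 → algX.m t = A *ᵥ algY.xt t)
    (hmY : ∀ t, 1 ≤ t → algY.rt t ≠ 0 → algY.m t = -(Aᵀ *ᵥ algX.xt t))
    (huX : ∀ t, 1 ≤ t → algX.u t = A *ᵥ algY.x t)
    (huY : ∀ t, 1 ≤ t → algY.u t = -(Aᵀ *ᵥ algX.x t))
    (hinitX : algX.rt 1 = 0) (hinitY : algY.rt 1 = 0) :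
    ∃ C : ℝ, 0 ≤ C ∧ ∀ T : ℕ, 1 ≤ T → ∃ t ∈ Finset.Icc 1 T,
      sSup ((fun xs : Fin m → ℝ => dotp xs (A *ᵥ algY.x t))
          '' stdSimplex ℝ (Fin m))
        - sInf ((fun ys : Fin n → ℝ => dotp (Aᵀ *ᵥ algX.x t) ys)
          '' stdSimplex ℝ (Fin n))
        ≤ C / Real.sqrt T := by
  set α := (∑ i, ∑ j, |A i j|) + ∑ i, ∑ j, |Aᵀ i j| with hα
  have hα1 : 0 ≤ ∑ i, ∑ j, |A i j| :=
    Finset.sum_nonneg fun _ _ => Finset.sum_nonneg fun _ _ => abs_nonneg _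
  have hα2 : 0 ≤ ∑ i, ∑ j, |Aᵀ i j| :=
    Finset.sum_nonneg fun _ _ => Finset.sum_nonneg fun _ _ => abs_nonneg _
  have hsqrtX : ∀ t, √(algX.moveSq t) = ∑ i, |algX.x t i - algX.xt t i| := fun t =>
    Real.sqrt_sq (Finset.sum_nonneg fun _ _ => abs_nonneg _)
  have hsqrtY : ∀ t, √(algY.moveSq t) = ∑ i, |algY.x t i - algY.xt t i| := fun t =>
    Real.sqrt_sq (Finset.sum_nonneg fun _ _ => abs_nonneg _)
  obtain ⟨K₁, hK₁, hev₁⟩ := algX.eventually_estimates (α := α) algY.moveSq_nonneg (by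
    intro t ht h i
    rw [huX t ht, hmX t ht h, hsqrtY]
    refine (abs_mulVec_sub_le A _ _ i).trans ?_
    gcongr
    linarith)
  obtain ⟨K₂, hK₂, hev₂⟩ := algY.eventually_estimates (α := α) algX.moveSq_nonneg (by
    intro t ht h i
    rw [huY t ht, hmY t ht h, hsqrtX]
    have := abs_mulVec_sub_le Aᵀ (algX.x t) (algX.xt t) i
    have e : (-(Aᵀ *ᵥ algX.x t)) i - (-(Aᵀ *ᵥ algX.xt t)) i
        = -((Aᵀ *ᵥ algX.x t - Aᵀ *ᵥ algX.xt t) i) := by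
      simp only [Pi.neg_apply, Pi.sub_apply]
      ring
    rw [e, abs_neg]
    refine this.trans ?_
    gcongr
    linarith)
  obtain ⟨s, hs⟩ := Filter.eventually_atTop.1
    ((hev₁.and hev₂).and (Filter.eventually_ge_atTop 1))
  have hs1 : 1 ≤ s := (hs s le_rfl).2
  have hXD := algX.excess_nonneg
  have hYD := algY.excess_nonneg
  set Q : ℕ → ℝ := fun t => ∑ k ∈ Finset.Ico s t, (algX.excess k + algY.excess k) with hQ
  have hQle : ∀ t, s ≤ t → Q t ≤ √(algX.normSq t) + √(algY.normSq t) := fun t ht =>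
    sum_excess_le A algX algY huX huY hs1 ht
  set V : ℕ → ℝ := fun t => algX.normSq t + algY.normSq t with hV
  set K := K₁ * K₂ with hK
  have hK0 : 0 ≤ K := mul_nonneg hK₁ hK₂
  have hVle : ∀ t, s ≤ t → V t ≤ V s + K * Q t := by
    intro t ht
    induction t, ht using Nat.le_induction with
    | base => simp [hQ]
    | succ t ht ih =>
      obtain ⟨⟨⟨a1, a2, -⟩, b1, b2, -⟩, -⟩ := hs t ht
      have h1 := mul_le_mul_of_nonneg_left b1 hK₁
      have h2 := mul_le_mul_of_nonneg_left a1 hK₂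
      simp only [hQ, hV, Finset.sum_Ico_succ_top ht] at ih ⊢
      rw [hK] at ih ⊢
      linarith
  have hV0 : 0 ≤ V s := add_nonneg (algX.normSq_nonneg s) (algY.normSq_nonneg s)
  set B := 2 * V s + 2 * K + 1 with hB
  have hB0 : 0 ≤ B := by positivity
  have hW : ∀ t, s ≤ t → √(algX.normSq t) + √(algY.normSq t) ≤ B := by
    intro t ht
    refine le_of_sq_le_add_mul (by positivity) (by positivity) ?_
    have h1 := hVle t ht
    have h2 := mul_le_mul_of_nonneg_left (hQle t ht) hK0
    have h3 := Real.sq_sqrt (algX.normSq_nonneg t)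
    have h4 := Real.sq_sqrt (algY.normSq_nonneg t)
    simp only [hV] at h1 ⊢
    nlinarith [sq_nonneg (√(algX.normSq t) - √(algY.normSq t))]
  set L := 2 * K + (K₁ + K₂) * B with hL
  have hL0 : 0 ≤ L := by positivity
  have hstep : ∀ t, s ≤ t →
      algX.stepSq t + algY.stepSq t ≤ L * (algX.excess t + algY.excess t) := by
    intro t ht
    obtain ⟨⟨⟨a1, -, a3⟩, b1, -, b3⟩, -⟩ := hs t ht
    have hw := hW t ht
    have hx0 := Real.sqrt_nonneg (algX.normSq t)
    have hy0 := Real.sqrt_nonneg (algY.normSq t)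
    have h1 : algX.stepSq t ≤ K₁ * (K₂ * algY.excess t + B * algX.excess t) := by
      refine a3.trans ?_
      have := hXD t
      gcongr
      linarith
    have h2 : algY.stepSq t ≤ K₂ * (K₁ * algX.excess t + B * algY.excess t) := by
      refine b3.trans ?_
      have := hYD t
      gcongr
      linarith
    have p1 := mul_nonneg hK0 (hXD t)
    have p2 := mul_nonneg hK0 (hYD t)
    have p3 := mul_nonneg (mul_nonneg hK₁ hB0) (hYD t)
    have p4 := mul_nonneg (mul_nonneg hK₂ hB0) (hXD t)
    rw [hL, hK] at *
    nlinarith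
  set F : ℕ → ℝ := fun t => algX.stepSq t + algY.stepSq t with hF
  have hF0 : ∀ t, 0 ≤ F t := fun t => add_nonneg (algX.stepSq_nonneg t) (algY.stepSq_nonneg t)
  set M := ∑ k ∈ Finset.Ico 1 s, F k + L * B with hM
  have hM0 : 0 ≤ M := add_nonneg (Finset.sum_nonneg fun _ _ => hF0 _) (mul_nonneg hL0 hB0)
  have hsum : ∀ T, 1 ≤ T → ∑ k ∈ Finset.Icc 1 T, F k ≤ M := by
    intro T hT
    calc ∑ k ∈ Finset.Icc 1 T, F k ≤ ∑ k ∈ Finset.Ico 1 (s + T), F k := by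
          refine Finset.sum_le_sum_of_subset_of_nonneg ?_ fun k _ _ => hF0 k
          intro k hk
          simp only [Finset.mem_Icc, Finset.mem_Ico] at hk ⊢
          omega
      _ = ∑ k ∈ Finset.Ico 1 s, F k + ∑ k ∈ Finset.Ico s (s + T), F k :=
          (Finset.sum_Ico_consecutive F hs1 (by omega)).symm
      _ ≤ ∑ k ∈ Finset.Ico 1 s, F k + L * Q (s + T) := by
          rw [hQ, Finset.mul_sum]
          gcongr with k hk
          exact hstep k (Finset.mem_Ico.1 hk).1
      _ ≤ M := by
          rw [hM]
          gcongr
          exact (hQle _ (by omega)).trans (hW _ (by omega))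
  refine ⟨√(2 * M), Real.sqrt_nonneg _, fun T hT => ?_⟩
  have hTpos : (0 : ℝ) < T := by exact_mod_cast hT
  obtain ⟨t, ht, htM⟩ : ∃ t ∈ Finset.Icc 1 T, F t ≤ M / T := by
    refine Finset.exists_le_of_sum_le (Finset.nonempty_Icc.2 hT) ?_
    rw [Finset.sum_const, Nat.card_Icc, nsmul_eq_mul, Nat.add_sub_cancel]
    rw [mul_div_cancel₀ _ hTpos.ne']
    exact hsum T hT
  refine ⟨t, ht, (dualityGap_le A algX algY huX huY (Finset.mem_Icc.1 ht).1).trans ?_⟩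
  rw [← Real.sqrt_div (by positivity)]
  refine Real.le_sqrt_of_sq_le ?_
  have h3 := Real.sq_sqrt (algX.stepSq_nonneg t)
  have h4 := Real.sq_sqrt (algY.stepSq_nonneg t)
  have h5 : 2 * M / T = 2 * (M / T) := by ring
  simp only [hF] at htM
  nlinarith [sq_nonneg (√(algX.stepSq t) - √(algY.stepSq t))]
end

section
/- Let r ∈ ℝⁿ with r ≥ 0, and let u ∈ ℝⁿ. Define x := r/‖r‖₁ if r ≠ 0, and let x be an arbitrary point of Δ(n) if r = 0. Let r' := [r + u − ⟨x, u⟩1]⁺, and assume r' ≠ 0; set x' := r'/‖r'‖₁. Then ⟨x' − x, u⟩ ≥ (1/‖r'‖₁) (max_{a ∈ [n]} u_a − ⟨x, u⟩)². -/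
theorem l1_eq_sum_of_nonneg {d : ℕ} {v : Fin d → ℝ} (hv : ∀ i, 0 ≤ v i) : l1 v = ∑ i, v i :=
  Finset.sum_congr rfl fun i _ => abs_of_nonneg (hv i)

theorem l1_pos {d : ℕ} {v : Fin d → ℝ} (hv : v ≠ 0) : 0 < l1 v := by
  obtain ⟨i, hi⟩ := Function.ne_iff.mp hv
  exact Finset.sum_pos' (fun j _ => abs_nonneg (v j)) ⟨i, Finset.mem_univ i, abs_pos.mpr hi⟩

theorem inv_l1_smul_mem_stdSimplex {d : ℕ} {v : Fin d → ℝ} (hv : ∀ i, 0 ≤ v i) (hne : v ≠ 0) :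
    (l1 v)⁻¹ • v ∈ stdSimplex ℝ (Fin d) := by
  have hpos := l1_pos hne
  refine ⟨fun i => mul_nonneg (inv_nonneg.mpr hpos.le) (hv i), ?_⟩
  simp only [Pi.smul_apply, smul_eq_mul]
  rw [← Finset.mul_sum, ← l1_eq_sum_of_nonneg hv, inv_mul_cancel₀ hpos.ne']

theorem dotp_le_of_mem_stdSimplex {d : ℕ} {x u : Fin d → ℝ} {b : ℝ}
    (hx : x ∈ stdSimplex ℝ (Fin d)) (hu : ∀ i, u i ≤ b) : dotp x u ≤ b :=
  calc dotp x u ≤ ∑ i, x i * b :=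
        Finset.sum_le_sum fun i _ => mul_le_mul_of_nonneg_left (hu i) (hx.1 i)
    _ = b := by rw [← Finset.sum_mul, hx.2, one_mul]

/-- Adding `g` to a nonnegative number and truncating at zero moves in the direction of `g`. -/
theorem max_add_sub_mul_nonneg {r g : ℝ} (hr : 0 ≤ r) : 0 ≤ (max (r + g) 0 - r) * g := by
  rcases le_total 0 (r + g) with h | h
  · rw [max_eq_left h]
    nlinarith [sq_nonneg g]
  · rw [max_eq_right h]
    nlinarith

/-- one-step improvement for RM⁺: with `r ≥ 0`,
`x = r/‖r‖₁` (an arbitrary point of `Δ(n)` if `r = 0`),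
`r' = [r + u - ⟨x,u⟩1]⁺ ≠ 0`, and `x' = r'/‖r'‖₁`, one has
`⟨x' - x, u⟩ ≥ (1/‖r'‖₁)(max_a u_a - ⟨x,u⟩)²`. -/
theorem stmt19 {n : ℕ} (r u x : Fin n → ℝ) (hrnn : ∀ i, 0 ≤ r i)
    (hx0 : r = 0 → x ∈ stdSimplex ℝ (Fin n))
    (hx : r ≠ 0 → x = (l1 r)⁻¹ • r)
    (r' x' : Fin n → ℝ)
    (hr' : r' = ppart (r + u - (dotp x u) • (1 : Fin n → ℝ)))
    (hr'ne : r' ≠ 0)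
    (hx' : x' = (l1 r')⁻¹ • r') :
    (1 / l1 r') * ((⨆ a, u a) - dotp x u) ^ 2 ≤ dotp (x' - x) u := by
  have hxs : x ∈ stdSimplex ℝ (Fin n) := by
    by_cases h : r = 0
    · exact hx0 h
    · rw [hx h]
      exact inv_l1_smul_mem_stdSimplex hrnn h
  have hrx : ∀ i, r i = l1 r * x i := by
    intro i
    by_cases h : r = 0
    · simp [h, l1]
    · have hxi : x i = (l1 r)⁻¹ * r i := by
        rw [congrFun (hx h) i]
        rfl
      rw [hxi, mul_inv_cancel_left₀ (l1_pos h).ne']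
  set c := dotp x u with hc
  have hr'i : ∀ i, r' i = max (r i + (u i - c)) 0 := by
    intro i
    simp [hr', ppart, add_sub_assoc]
  have hpos := l1_pos hr'ne
  have hsum : l1 r' = ∑ i, r' i := l1_eq_sum_of_nonneg fun i => by
    rw [hr'i]
    exact le_max_right _ _
  obtain ⟨j, -⟩ := Function.ne_iff.mp hr'ne
  have : Nonempty (Fin n) := ⟨j⟩
  obtain ⟨a, ha⟩ := exists_eq_ciSup_of_finite (f := u)
  have hca : c ≤ u a := dotp_le_of_mem_stdSimplex hxs fun i => by
    rw [ha]
    exact le_ciSup (Set.finite_range u).bddAbove i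
  have horth : ∑ i, r i * (u i - c) = 0 := by
    calc ∑ i, r i * (u i - c) = ∑ i, l1 r * (x i * u i - x i * c) :=
          Finset.sum_congr rfl fun i _ => by rw [hrx i]; ring
      _ = 0 := by
          rw [← Finset.mul_sum, Finset.sum_sub_distrib, ← Finset.sum_mul, hxs.2, hc, dotp]
          ring
  have hgain : (u a - c) ^ 2 ≤ ∑ i, r' i * (u i - c) := by
    calc (u a - c) ^ 2 = (r' a - r a) * (u a - c) := by
          rw [hr'i, max_eq_left (by linarith [hrnn a])]
          ring
      _ ≤ ∑ i, (r' i - r i) * (u i - c) :=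
          Finset.single_le_sum (f := fun i => (r' i - r i) * (u i - c))
            (fun i _ => by
              simp only [hr'i]
              exact max_add_sub_mul_nonneg (hrnn i)) (Finset.mem_univ a)
      _ = ∑ i, r' i * (u i - c) := by
          simp only [sub_mul _ _ (u _ - c), Finset.sum_sub_distrib, horth, sub_zero]
  have hdiff : dotp (x' - x) u = 1 / l1 r' * ∑ i, r' i * (u i - c) := by
    have hx'u : dotp (x' - x) u = (l1 r')⁻¹ * ∑ i, r' i * u i - c := by
      simp only [hc, dotp, hx', Pi.sub_apply, Pi.smul_apply, smul_eq_mul, sub_mul,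
        Finset.sum_sub_distrib, Finset.mul_sum, mul_assoc]
    simp only [hx'u, mul_sub, Finset.sum_sub_distrib]
    rw [← Finset.sum_mul, ← hsum]
    field_simp
  rw [hdiff, ← ha]
  exact mul_le_mul_of_nonneg_left hgain (by positivity)
end
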